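/- Let n ≥ 1 and let Q = 4^{−n} Σ_v (P_v)^{⊗4}, where the sum runs over all 4ⁿ Pauli strings on n qubits. Then Q is an orthogonal projection (Q is Hermitian and Q² = Q), and Q commutes with the permutation operator P_σ on the 4-fold tensor power for every permutation σ of {1,2,3,4}. -/

import Mathlib

open Matrix

/-- The four single-qubit Pauli matrices `I, X, Y, Z`. -/
noncomputable def pauliMat : Fin 4 → Matrix (Fin 2) (Fin 2) ℂ
  | 0 => 1
  | 1 => !![0, 1; 1, 0]
  | 2 => !![0, -Complex.I; Complex.I, 0]
  | 3 => !![1, 0; 0, -1]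

/-- The Pauli string `P_v = σ_{v 0} ⊗ ⋯ ⊗ σ_{v (n-1)}` as a `2ⁿ × 2ⁿ` matrix
indexed by functions `Fin n → Fin 2`. -/
noncomputable def pauliString {n : ℕ} (v : Fin n → Fin 4) :
    Matrix (Fin n → Fin 2) (Fin n → Fin 2) ℂ :=
  Matrix.of fun a b => ∏ i, pauliMat (v i) (a i) (b i)

/-- The 4-fold tensor (Kronecker) power of a square matrix, indexed by 4-tuples. -/
noncomputable def tpow4 {ι : Type*} [Fintype ι] (A : Matrix ι ι ℂ) :
    Matrix (Fin 4 → ι) (Fin 4 → ι) ℂ :=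
  Matrix.of fun a b => ∏ k, A (a k) (b k)

/-- The permutation operator `P_σ` on the 4-fold tensor power:
`(P_σ)_{a,b} = 1` if `a (σ k) = b k` for all `k`, else `0`. -/
noncomputable def permOp4 {ι : Type*} [DecidableEq ι] (σ : Equiv.Perm (Fin 4)) :
    Matrix (Fin 4 → ι) (Fin 4 → ι) ℂ :=
  Matrix.of fun a b => if ∀ k, a (σ k) = b k then 1 else 0

/-- The projector `Q = 4^{−n} Σ_v (P_v)^{⊗4}` onto the span of 4-fold Pauli tensor powers. -/
noncomputable def pauliQ (n : ℕ) :
    Matrix (Fin 4 → (Fin n → Fin 2)) (Fin 4 → (Fin n → Fin 2)) ℂ :=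
  ((4 : ℂ) ^ n)⁻¹ • ∑ v : Fin n → Fin 4, tpow4 (pauliString v)

/-- Kronecker products of finite families of matrices multiply factorwise. -/
theorem of_prod_mul_of_prod {ι κ R : Type*} [Fintype ι] [DecidableEq ι] [Fintype κ]
    [CommSemiring R] (A B : ι → Matrix κ κ R) :
    (Matrix.of fun a b : ι → κ => ∏ i, A i (a i) (b i)) *
        (Matrix.of fun a b : ι → κ => ∏ i, B i (a i) (b i)) =
      Matrix.of fun a b : ι → κ => ∏ i, (A i * B i) (a i) (b i) := by
  ext a b
  simp only [Matrix.mul_apply, Matrix.of_apply, ← Finset.prod_mul_distrib]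
  rw [Finset.prod_univ_sum, Fintype.piFinset_univ]

theorem pauliMat_conjTranspose (i : Fin 4) : (pauliMat i)ᴴ = pauliMat i := by
  fin_cases i <;> ext a b <;> fin_cases a <;> fin_cases b <;> simp [pauliMat]

/-- Up to a fourth root of unity, the product of two Pauli matrices is the Pauli matrix
whose label is the bitwise exclusive or. -/
theorem pauliMat_mul_pauliMat (i j : Fin 4) :
    ∃ c : ℂ, c ^ 4 = 1 ∧ pauliMat i * pauliMat j = c • pauliMat (i ^^^ j) := by
  have h : ∃ c ∈ ({1, Complex.I, -Complex.I} : Set ℂ),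
      pauliMat i * pauliMat j = c • pauliMat (i ^^^ j) := by
    simp only [Set.mem_insert_iff, Set.mem_singleton_iff, exists_eq_or_imp, exists_eq_left]
    fin_cases i <;> fin_cases j <;>
      first
      | refine Or.inl ?_
        ext a b
        fin_cases a <;> fin_cases b <;> simp [pauliMat, Matrix.mul_apply] <;> done
      | refine Or.inr (Or.inl ?_)
        ext a b
        fin_cases a <;> fin_cases b <;> simp [pauliMat, Matrix.mul_apply] <;> done
      | refine Or.inr (Or.inr ?_)
        ext a b
        fin_cases a <;> fin_cases b <;> simp [pauliMat, Matrix.mul_apply]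
  obtain ⟨c, hc, h⟩ := h
  refine ⟨c, ?_, h⟩
  rcases hc with rfl | rfl | rfl <;> simp [Even.neg_pow (by decide : Even 4)]

theorem pauliString_conjTranspose {n : ℕ} (v : Fin n → Fin 4) :
    (pauliString v)ᴴ = pauliString v := by
  ext a b
  simp only [pauliString, Matrix.conjTranspose_apply, Matrix.of_apply, star_prod]
  exact Finset.prod_congr rfl fun i _ => congrFun₂ (pauliMat_conjTranspose (v i)) (a i) (b i)

theorem pauliString_mul_pauliString {n : ℕ} (v w : Fin n → Fin 4) :
    ∃ c : ℂ, c ^ 4 = 1 ∧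
      pauliString v * pauliString w = c • pauliString fun i => v i ^^^ w i := by
  choose c hc h using fun i => pauliMat_mul_pauliMat (v i) (w i)
  refine ⟨∏ i, c i, by simp [← Finset.prod_pow, hc], ?_⟩
  ext a b
  simp [pauliString, of_prod_mul_of_prod, h, Finset.prod_mul_distrib]

section TensorPower

variable {ι : Type*} [Fintype ι]

theorem tpow4_conjTranspose (A : Matrix ι ι ℂ) : (tpow4 A)ᴴ = tpow4 Aᴴ := by
  ext a b
  simp [tpow4]

theorem tpow4_mul (A B : Matrix ι ι ℂ) : tpow4 A * tpow4 B = tpow4 (A * B) :=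
  of_prod_mul_of_prod (fun _ => A) fun _ => B

theorem tpow4_smul (c : ℂ) (A : Matrix ι ι ℂ) : tpow4 (c • A) = c ^ 4 • tpow4 A := by
  ext a b
  simp [tpow4, Finset.prod_mul_distrib]

theorem tpow4_mul_permOp4 [DecidableEq ι] (A : Matrix ι ι ℂ) (σ : Equiv.Perm (Fin 4)) :
    tpow4 A * permOp4 σ = permOp4 σ * tpow4 A := by
  ext a b
  have hl (c : Fin 4 → ι) : (∀ k, c (σ k) = b k) ↔ c = b ∘ σ.symm :=
    funext_iff.symm.trans (Equiv.eq_comp_symm σ c b).symm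
  have hr (c : Fin 4 → ι) : (∀ k, a (σ k) = c k) ↔ a ∘ σ = c := funext_iff.symm
  simp only [Matrix.mul_apply, tpow4, permOp4, Matrix.of_apply, hl, hr, mul_ite, mul_one,
    mul_zero, ite_mul, one_mul, zero_mul, Finset.sum_ite_eq, Finset.sum_ite_eq',
    Finset.mem_univ, if_true]
  rw [← Equiv.prod_comp σ]
  simp

end TensorPower

theorem tpow4_pauliString_mul {n : ℕ} (v w : Fin n → Fin 4) :
    tpow4 (pauliString v) * tpow4 (pauliString w) =
      tpow4 (pauliString fun i => v i ^^^ w i) := by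
  obtain ⟨c, hc, h⟩ := pauliString_mul_pauliString v w
  rw [tpow4_mul, h, tpow4_smul, hc, one_smul]

theorem tpow4_pauliString_mul_sum {n : ℕ} (v : Fin n → Fin 4) :
    tpow4 (pauliString v) * ∑ w : Fin n → Fin 4, tpow4 (pauliString w) =
      ∑ w : Fin n → Fin 4, tpow4 (pauliString w) := by
  have hxor : ∀ i j : Fin 4, i ^^^ (i ^^^ j) = j := by decide
  have hinv : Function.Involutive fun (w : Fin n → Fin 4) i => v i ^^^ w i :=
    fun w => funext fun i => hxor (v i) (w i)
  simp only [Finset.mul_sum, tpow4_pauliString_mul]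
  exact hinv.bijective.sum_comp fun w => tpow4 (pauliString w)

/-- `Q = 4^{−n} Σ_v (P_v)^{⊗4}` is an orthogonal projection and commutes
with every permutation operator on the 4-fold tensor power. -/
theorem pauliQ_isProjection_and_commutes {n : ℕ} (hn : 1 ≤ n) :
    (pauliQ n).IsHermitian ∧ pauliQ n * pauliQ n = pauliQ n ∧
      ∀ σ : Equiv.Perm (Fin 4), pauliQ n * permOp4 σ = permOp4 σ * pauliQ n := by
  refine ⟨?_, ?_, fun σ => ?_⟩
  · simp [Matrix.IsHermitian, pauliQ, Matrix.conjTranspose_smul, Matrix.conjTranspose_sum,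
      tpow4_conjTranspose, pauliString_conjTranspose]
  · have h4 : (4 : ℂ) ^ n ≠ 0 := pow_ne_zero n (by norm_num)
    rw [pauliQ, smul_mul_smul_comm, Finset.sum_mul]
    simp only [tpow4_pauliString_mul_sum]
    rw [Finset.sum_const, ← Nat.cast_smul_eq_nsmul ℂ, smul_smul]
    simp [h4]
  · simp only [pauliQ, smul_mul_assoc, mul_smul_comm, Finset.sum_mul, Finset.mul_sum,
      tpow4_mul_permOp4]
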